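/- arXiv:math/0311375 — 12 statements merged into one kernel-verified Lean document; each statement's English description precedes it below -/
import Mathlib

section
/- Let k be a field and let A be a unital associative k-algebra with no zero divisors (a domain) that is amenable. Then A satisfies the Ore condition: for any nonzero elements a, b ∈ A one has aA ∩ bA ≠ 0, i.e. there exist x, y ∈ A with ax = by ≠ 0. -/
/-- A unital associative algebra `A` over a field `k` is *amenable* if for every finite
list `r₁, …, rₙ` of elements of `A` and every `ε > 0` there is a nonzero
finite-dimensional `k`-subspace `V ⊆ A` with
`dim_k (r₁V + ⋯ + rₙV) < (1 + ε) · dim_k V`. -/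
def IsAmenableAlgebra (k A : Type*) [Field k] [Ring A] [Algebra k A] : Prop :=
  ∀ (n : ℕ) (r : Fin n → A) (ε : ℝ), 0 < ε →
    ∃ V : Submodule k A, V ≠ ⊥ ∧ FiniteDimensional k V ∧
      (Module.finrank k ↥(⨆ i, V.map (LinearMap.mulLeft k (r i))) : ℝ) <
        (1 + ε) * (Module.finrank k V : ℝ)

/-- An amenable domain satisfies the (right common multiple form of the) Ore condition:
for nonzero `a b : A` we have `aA ∩ bA ≠ 0`. -/
theorem amenable_domain_ore (k A : Type*) [Field k] [Ring A] [IsDomain A] [Algebra k A]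
    (hA : IsAmenableAlgebra k A) (a b : A) (ha : a ≠ 0) (hb : b ≠ 0) :
    ∃ x y : A, a * x = b * y ∧ a * x ≠ 0 := by
  obtain ⟨V, -, _, hlt⟩ := hA 2 ![a, b] 1 one_pos
  have hfin (c : A) (hc : c ≠ 0) :
      Module.finrank k (V.map (LinearMap.mulLeft k c)) = Module.finrank k V :=
    (Submodule.equivMapOfInjective _ (mul_right_injective₀ hc) V).finrank_eq.symm
  have hsup : ⨆ i, V.map (LinearMap.mulLeft k (![a, b] i)) =
      V.map (LinearMap.mulLeft k a) ⊔ V.map (LinearMap.mulLeft k b) := by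
    refine le_antisymm (iSup_le fun i => ?_) (sup_le ?_ ?_)
    · fin_cases i
      · exact le_sup_left
      · exact le_sup_right
    · exact le_iSup (fun i => V.map (LinearMap.mulLeft k (![a, b] i))) 0
    · exact le_iSup (fun i => V.map (LinearMap.mulLeft k (![a, b] i))) 1
  have hinf : V.map (LinearMap.mulLeft k a) ⊓ V.map (LinearMap.mulLeft k b) ≠ ⊥ := by
    intro h
    have hadd := Submodule.finrank_sup_add_finrank_inf_eq
      (V.map (LinearMap.mulLeft k a)) (V.map (LinearMap.mulLeft k b))
    rw [h, finrank_bot, hfin a ha, hfin b hb] at hadd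
    rw [hsup] at hlt
    have hadd' := congrArg (Nat.cast (R := ℝ)) hadd
    push_cast at hadd'
    linarith
  obtain ⟨_, ⟨⟨x, -, hx⟩, ⟨y, -, hy⟩⟩, hz⟩ := Submodule.exists_mem_ne_zero_of_ne_bot hinf
  exact ⟨x, y, hx.trans hy.symm, fun h => hz (hx.symm.trans h)⟩
end

section
/- Let k be a field and let A be a unital associative k-algebra with no zero divisors that is amenable, and suppose the set of nonzero elements of A is an Ore set, so that the classical ring of quotients Q (the Ore localization of A at its nonzero elements, a division ring containing A) exists. Then Q is an amenable k-algebra. -/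
/-- Finitely many elements of a ring of right fractions have a common right denominator. -/
theorem exists_common_right_denominator {A Q ι : Type*} [Ring A] [IsDomain A] [DivisionRing Q]
    (f : A →+* Q) (hf : Function.Injective f)
    (hQ : ∀ q : Q, ∃ a s : A, s ≠ 0 ∧ q = f a * (f s)⁻¹) (r : ι → Q) (S : Finset ι) :
    ∃ s : A, s ≠ 0 ∧ ∀ i ∈ S, ∃ a : A, r i * f s = f a := by
  classical
  induction S using Finset.induction_on with
  | empty => exact ⟨1, one_ne_zero, by simp⟩
  | insert j S _ ih =>
    obtain ⟨s, hs, h⟩ := ih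
    obtain ⟨b, t, ht, hb⟩ := hQ (r j * f s)
    have hft : f t ≠ 0 := (map_ne_zero_iff f hf).2 ht
    refine ⟨s * t, mul_ne_zero hs ht, fun i hi => ?_⟩
    rcases Finset.mem_insert.1 hi with rfl | hi
    · exact ⟨b, by rw [map_mul, ← mul_assoc, hb, inv_mul_cancel_right₀ hft]⟩
    · obtain ⟨a, ha⟩ := h i hi
      exact ⟨a * t, by rw [map_mul, map_mul, ← mul_assoc, ha]⟩

/-- If `A` is an amenable Ore domain, then its classical ring of quotients `Q`
(a division ring in which every element has the form `a · s⁻¹` with `a, s ∈ A`, `s ≠ 0`)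
is an amenable `k`-algebra. -/
theorem amenable_of_classical_quotient_ring (k A Q : Type*) [Field k] [Ring A] [IsDomain A]
    [Algebra k A] [DivisionRing Q] [Algebra k Q]
    (f : A →ₐ[k] Q) (hf : Function.Injective f)
    (hQ : ∀ q : Q, ∃ a s : A, s ≠ 0 ∧ q = f a * (f s)⁻¹)
    (hA : IsAmenableAlgebra k A) :
    IsAmenableAlgebra k Q := by
  intro n r ε hε
  obtain ⟨s, hs, h⟩ := exists_common_right_denominator (f : A →+* Q) hf hQ r Finset.univ
  choose a ha using fun i => h i (Finset.mem_univ i)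
  obtain ⟨W, hW, hWfin, hlt⟩ := hA n a ε hε
  have hfs : f s ≠ 0 := (map_ne_zero_iff f hf).2 hs
  let g : A →ₗ[k] Q := LinearMap.mulLeft k (f s) ∘ₗ f.toLinearMap
  have hg : Function.Injective g := (mul_right_injective₀ hfs).comp hf
  have hmap : ⨆ i, (W.map g).map (LinearMap.mulLeft k (r i)) =
      (⨆ i, W.map (LinearMap.mulLeft k (a i))).map f.toLinearMap := by
    rw [Submodule.map_iSup]
    refine iSup_congr fun i => ?_
    rw [← Submodule.map_comp, ← Submodule.map_comp]
    congr 1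
    ext x
    have hi : r i * f s = f (a i) := ha i
    simp [g, ← mul_assoc, hi]
  refine ⟨W.map g, fun h0 => hW ?_, inferInstance, ?_⟩
  · exact Submodule.map_injective_of_injective hg (h0.trans (Submodule.map_bot g).symm)
  · rw [hmap, ← (Submodule.equivMapOfInjective g hg W).finrank_eq,
      ← (Submodule.equivMapOfInjective f.toLinearMap hf _).finrank_eq]
    exact hlt
end

section
/- Let k be a field, D a division ring containing k as a central subfield (a k-division algebra), x₁,…,x_m nonzero elements of D, ε > 0 a real number, and W a nonzero finite-dimensional k-subspace of D such that dim_k(W + x₁W + ⋯ + x_mW) ≤ (1+ε)·dim_k W. Then the k-subspace Z = {v ∈ W : x_i v ∈ W for all i = 1,…,m} satisfies dim_k Z ≥ (1 − m·ε)·dim_k W. -/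
open Module in
/-- If an injective linear map `f` sends `V` into a finite-dimensional `U` containing `W`, then
passing from `V` to `V ⊓ f⁻¹(W)` lowers the dimension by at most `dim U - dim W`. -/
theorem Submodule.finrank_add_finrank_le_finrank_inf_comap_add {k E F : Type*} [DivisionRing k]
    [AddCommGroup E] [Module k E] [AddCommGroup F] [Module k F] {f : E →ₗ[k] F}
    (hf : Function.Injective f) {V : Submodule k E} {W U : Submodule k F} [FiniteDimensional k U]
    (hW : W ≤ U) (hV : V.map f ≤ U) :
    finrank k V + finrank k W ≤ finrank k ↥(V ⊓ W.comap f) + finrank k U := by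
  have : FiniteDimensional k W := Submodule.finiteDimensional_of_le hW
  have : FiniteDimensional k (V.map f) := Submodule.finiteDimensional_of_le hV
  have hsum := Submodule.finrank_sup_add_finrank_inf_eq (V.map f) W
  have hinf : V.map f ⊓ W = (V ⊓ W.comap f).map f :=
    SetLike.coe_injective (by simp [Set.image_inter_preimage])
  rw [hinf, (Submodule.equivMapOfInjective f hf _).symm.finrank_eq,
    (Submodule.equivMapOfInjective f hf _).symm.finrank_eq] at hsum
  have := Submodule.finrank_mono (sup_le hV hW)
  omega

open Module in
/-- If injective endomorphisms `f i` map `W` into a finite-dimensional `U` containing `W`, then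
the part of `W` sent into `W` by the `f i` with `i ∈ s` has codimension at most
`#s * (dim U - dim W)` in `W`. -/
theorem Submodule.finrank_add_card_mul_finrank_le {k E ι : Type*} [DivisionRing k]
    [AddCommGroup E] [Module k E] {f : ι → E →ₗ[k] E} (hf : ∀ i, Function.Injective (f i))
    {W U : Submodule k E} [FiniteDimensional k U] (hW : W ≤ U) (hU : ∀ i, W.map (f i) ≤ U)
    (s : Finset ι) :
    finrank k W + s.card * finrank k W ≤
      finrank k ↥(W ⊓ ⨅ i ∈ s, W.comap (f i)) + s.card * finrank k U := by
  classical
  induction s using Finset.induction_on with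
  | empty => rw [show (⨅ i ∈ (∅ : Finset ι), W.comap (f i)) = ⊤ by simp, inf_top_eq]; simp
  | insert a s ha ih =>
    have hstep := finrank_add_finrank_le_finrank_inf_comap_add (hf a) hW
      ((Submodule.map_mono (inf_le_left : W ⊓ ⨅ i ∈ s, W.comap (f i) ≤ W)).trans (hU a))
    rw [Finset.iInf_insert, inf_comm (W.comap (f a)), ← inf_assoc, Finset.card_insert_of_notMem ha]
    linarith

/-- Let `D` be a division ring containing the field `k` in its center, `x₁, …, x_m`
nonzero elements of `D`, `ε > 0`, and `W` a nonzero finite-dimensional `k`-subspace of `D`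
with `dim_k (W + x₁W + ⋯ + x_mW) ≤ (1+ε) · dim_k W`. Then the subspace
`Z = {v ∈ W : xᵢ v ∈ W for all i}` satisfies `dim_k Z ≥ (1 - m·ε) · dim_k W`. -/
theorem almost_invariant_subspace_lower_bound (k D : Type*) [Field k] [DivisionRing D]
    [Algebra k D] (m : ℕ) (x : Fin m → D) (hx : ∀ i, x i ≠ 0) (ε : ℝ) (hε : 0 < ε)
    (W : Submodule k D) (hW : W ≠ ⊥) [FiniteDimensional k W]
    (hdim : (Module.finrank k ↥(W ⊔ ⨆ i, W.map (LinearMap.mulLeft k (x i))) : ℝ) ≤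
      (1 + ε) * (Module.finrank k W : ℝ)) :
    (1 - (m : ℝ) * ε) * (Module.finrank k W : ℝ) ≤
      (Module.finrank k ↥(W ⊓ ⨅ i, W.comap (LinearMap.mulLeft k (x i))) : ℝ) := by
  have hle := Submodule.finrank_add_card_mul_finrank_le
    (f := fun i => LinearMap.mulLeft k (x i)) (fun i => mul_right_injective₀ (hx i))
    (U := W ⊔ ⨆ i, W.map (LinearMap.mulLeft k (x i))) le_sup_left
    (fun i => le_sup_of_le_right (le_iSup (fun i => W.map (LinearMap.mulLeft k (x i))) i))
    Finset.univ
  rw [Finset.card_fin, show (⨅ i ∈ Finset.univ, W.comap (LinearMap.mulLeft k (x i))) =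
    ⨅ i, W.comap (LinearMap.mulLeft k (x i)) by simp] at hle
  have hle' := (Nat.cast_le (α := ℝ)).mpr hle
  push_cast at hle'
  linarith [mul_le_mul_of_nonneg_left hdim (Nat.cast_nonneg (α := ℝ) m)]
end

section
/- Let k be a field and D a division ring that is a k-algebra. Suppose that for every finite list c₁,…,c_m of elements of D there exists a nonzero element r ∈ D such that the k-subalgebra of D generated by c₁r, c₂r, …, c_mr (together with 1) is an amenable k-algebra. Then D itself is an amenable k-algebra. -/
/-- If for every finite list `c₁, …, c_m` of elements of a division ring `D` (a `k`-algebra)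
there is a nonzero `r ∈ D` such that the `k`-subalgebra generated by `c₁r, …, c_mr` is
amenable, then `D` itself is amenable. -/
theorem amenable_of_twisted_generation (k D : Type*) [Field k] [DivisionRing D] [Algebra k D]
    (h : ∀ (m : ℕ) (c : Fin m → D), ∃ r : D, r ≠ 0 ∧
      IsAmenableAlgebra k (Algebra.adjoin k (Set.range fun i => c i * r))) :
    IsAmenableAlgebra k D := by
  intro n c ε hε
  obtain ⟨r, hr, hB⟩ := h n c
  set B := Algebra.adjoin k (Set.range fun i => c i * r)
  let b : Fin n → B := fun i => ⟨c i * r, Algebra.subset_adjoin ⟨i, rfl⟩⟩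
  obtain ⟨V, hV, hfin, hlt⟩ := hB n b ε hε
  let f : B →ₗ[k] D := LinearMap.mulLeft k r ∘ₗ B.val.toLinearMap
  have hval : Function.Injective B.val.toLinearMap := Subtype.val_injective
  have hf : Function.Injective f := (mul_right_injective₀ hr).comp hval
  have hcomp (i : Fin n) :
      LinearMap.mulLeft k (c i) ∘ₗ f = B.val.toLinearMap ∘ₗ LinearMap.mulLeft k (b i) := by
    ext x
    simp [f, b, mul_assoc]
  have hsup : ⨆ i, (V.map f).map (LinearMap.mulLeft k (c i)) =
      (⨆ i, V.map (LinearMap.mulLeft k (b i))).map B.val.toLinearMap := by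
    simp only [Submodule.map_iSup, ← Submodule.map_comp, hcomp]
  refine ⟨V.map f, fun h0 => hV (Submodule.map_injective_of_injective hf ?_), inferInstance, ?_⟩
  · rw [h0, Submodule.map_bot]
  rwa [hsup, ← (Submodule.equivMapOfInjective _ hval _).finrank_eq,
    ← (Submodule.equivMapOfInjective f hf V).finrank_eq]
end

section
/- Let k be a field and let L be a division ring that is a k-algebra, such that L is finite-dimensional as a module over its center Z(L). Then L is an amenable k-algebra. -/
/-- A sequence of positive naturals with polynomially bounded growth does not grow by a factor
`1 + ε` at every step. -/
theorem exists_succ_lt_one_add_mul_of_polynomial_bound (f : ℕ → ℕ) (C N : ℕ) (hpos : 0 < f 0)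
    (hf : ∀ m, f m ≤ (m + 1) ^ N * C) (ε : ℝ) (hε : 0 < ε) :
    ∃ m, (f (m + 1) : ℝ) < (1 + ε) * f m := by
  by_contra! hcon
  have hexp : ∀ m, (1 + ε) ^ m ≤ (f m : ℝ) := by
    intro m
    induction m with
    | zero => simpa using Nat.succ_le_of_lt hpos
    | succ m ih =>
      calc (1 + ε) ^ (m + 1) = (1 + ε) * (1 + ε) ^ m := by ring
        _ ≤ (1 + ε) * f m := by gcongr
        _ ≤ f (m + 1) := hcon m
  have hlim := ((tendsto_pow_const_div_const_pow_of_one_lt N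
    (show (1 : ℝ) < 1 + ε by linarith)).mul_const ((C : ℝ) * (1 + ε))).comp
    (Filter.tendsto_add_atTop_nat 1)
  rw [zero_mul] at hlim
  obtain ⟨m, hm⟩ := (hlim.eventually (gt_mem_nhds one_pos)).exists
  have hpow : (0 : ℝ) < (1 + ε) ^ m := by positivity
  have hle : (1 + ε) ^ m ≤ ((m : ℝ) + 1) ^ N * C :=
    (hexp m).trans (by exact_mod_cast hf m)
  have heq : ((m : ℝ) + 1) ^ N / (1 + ε) ^ (m + 1) * (C * (1 + ε)) =
      ((m : ℝ) + 1) ^ N * C / (1 + ε) ^ m := by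
    field_simp
    ring
  simp only [Function.comp_apply, Nat.cast_add, Nat.cast_one] at hm
  rw [heq, div_lt_one hpow] at hm
  linarith

section MonomialSpan

variable (k : Type*) {L I J : Type*} [Field k] [Ring L] [Algebra k L] [Fintype I]

/-- The `k`-span of the products of the `b j` with the monomials in the central elements `c i`
whose exponents are at most `m`. -/
def monomialSpan (c : I → Subring.center L) (b : J → L) (m : ℕ) : Submodule k L :=
  Submodule.span k (Set.range fun p : (I → Fin (m + 1)) × J =>
    ((∏ i, c i ^ (p.1 i : ℕ) : Subring.center L) : L) * b p.2)

variable {k}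

theorem mul_mem_monomialSpan (c : I → Subring.center L) (b : J → L) {m : ℕ} (e : I → ℕ)
    (he : ∀ i, e i ≤ m) (j : J) :
    ((∏ i, c i ^ e i : Subring.center L) : L) * b j ∈ monomialSpan k c b m :=
  Submodule.subset_span ⟨(fun i => ⟨e i, Nat.lt_succ_of_le (he i)⟩, j), rfl⟩

theorem mem_monomialSpan (c : I → Subring.center L) (b : J → L) (m : ℕ) (j : J) :
    b j ∈ monomialSpan k c b m := by
  simpa using mul_mem_monomialSpan (k := k) c b (m := m) 0 (fun _ => Nat.zero_le _) j

instance finiteDimensional_monomialSpan [Finite J] (c : I → Subring.center L) (b : J → L)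
    (m : ℕ) : FiniteDimensional k (monomialSpan k c b m) :=
  FiniteDimensional.span_of_finite k (Set.finite_range _)

theorem finrank_monomialSpan_le [Fintype J] (c : I → Subring.center L) (b : J → L) (m : ℕ) :
    Module.finrank k (monomialSpan k c b m) ≤ (m + 1) ^ Fintype.card I * Fintype.card J := by
  classical
  refine (finrank_range_le_card _).trans_eq ?_
  simp

theorem map_mulLeft_monomialSpan_le [Fintype J] (c : I → Subring.center L) (b : J → L) (r : L)
    (t : J → J → I) (hr : ∀ j, r * b j = ∑ j', (c (t j j') : L) * b j') (m : ℕ) :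
    (monomialSpan k c b m).map (LinearMap.mulLeft k r) ≤ monomialSpan k c b (m + 1) := by
  classical
  rw [monomialSpan, Submodule.map_span_le]
  rintro _ ⟨⟨e, j⟩, rfl⟩
  set z : Subring.center L := ∏ i, c i ^ (e i : ℕ) with hz
  have hcomm : r * (z : L) = z * r := Subring.mem_center_iff.mp z.2 r
  rw [LinearMap.mulLeft_apply, ← mul_assoc, hcomm, mul_assoc, hr, Finset.mul_sum]
  refine Submodule.sum_mem _ fun j' _ => ?_
  have hmul : z * c (t j j') = ∏ i, c i ^ ((e i : ℕ) + if i = t j j' then 1 else 0) := by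
    simp only [hz, pow_add, Finset.prod_mul_distrib]
    simp [pow_ite]
  rw [← mul_assoc, ← Subring.coe_mul, hmul]
  refine mul_mem_monomialSpan c b _ (fun i => ?_) j'
  have := (e i).is_lt
  split_ifs <;> omega

end MonomialSpan


/-- A division ring `L` (a `k`-algebra) which is finite dimensional over its center is
an amenable `k`-algebra. -/
theorem amenable_of_finiteDimensional_over_center (k L : Type*) [Field k] [DivisionRing L]
    [Algebra k L] [Module.Finite (Subring.center L) L] :
    IsAmenableAlgebra k L := by
  intro n r ε hε
  obtain ⟨d, b, hb⟩ := Module.Finite.exists_fin (R := Subring.center L) (M := L)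
  have hcoeff : ∀ (l : Fin n) (j : Fin d), ∃ a : Fin d → Subring.center L,
      ∑ j', a j' • b j' = r l * b j := fun l j =>
    (Submodule.mem_span_range_iff_exists_fun _).mp (hb ▸ Submodule.mem_top)
  choose a ha using hcoeff
  obtain ⟨j₀, hj₀⟩ : ∃ j, b j ≠ 0 := by
    by_contra! h
    have hbot : Submodule.span (Subring.center L) (Set.range b) = ⊥ := by
      rw [Submodule.span_eq_bot]
      rintro _ ⟨j, rfl⟩
      exact h j
    exact bot_ne_top (hbot.symm.trans hb)
  let c : Fin n × Fin d × Fin d → Subring.center L := fun p => a p.1 p.2.1 p.2.2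
  have hne : ∀ m, monomialSpan k c b m ≠ ⊥ := fun m h =>
    hj₀ ((Submodule.mem_bot k).mp (h ▸ mem_monomialSpan c b m j₀))
  obtain ⟨m, hm⟩ := exists_succ_lt_one_add_mul_of_polynomial_bound
    (fun m => Module.finrank k (monomialSpan k c b m)) _ _
    (Nat.pos_of_ne_zero fun h => hne 0 (Submodule.finrank_eq_zero.mp h))
    (finrank_monomialSpan_le c b) ε hε
  refine ⟨monomialSpan k c b m, hne m, inferInstance, lt_of_le_of_lt ?_ hm⟩
  have hle : ⨆ i, (monomialSpan k c b m).map (LinearMap.mulLeft k (r i)) ≤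
      monomialSpan k c b (m + 1) :=
    iSup_le fun l => map_mulLeft_monomialSpan_le c b (r l) (fun j j' => (l, j, j'))
      (fun j => (ha l j).symm) m
  exact_mod_cast Submodule.finrank_mono hle
end

section
/- Let k be a field and let A and B be unital associative k-algebras that are both amenable. Then the tensor product algebra A ⊗_k B is an amenable k-algebra. -/
open scoped TensorProduct

theorem Submodule.span_range_mul_eq_iSup_map_mulLeft {k A ι : Type*} [CommSemiring k]
    [Semiring A] [Algebra k A] (r : ι → A) (V : Submodule k A) :
    span k (Set.range r) * V = ⨆ i, V.map (LinearMap.mulLeft k (r i)) := by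
  apply le_antisymm
  · rw [span_range_eq_iSup, iSup_mul]
    refine iSup_mono fun i => mul_le.2 fun x hx y hy => ?_
    obtain ⟨c, rfl⟩ := mem_span_singleton.1 hx
    exact ⟨c • y, V.smul_mem c hy, by simp⟩
  · refine iSup_le fun i => map_le_iff_le_comap.2 fun y hy => ?_
    exact mul_mem_mul (subset_span ⟨i, rfl⟩) hy

theorem isAmenableAlgebra_iff_fg_mul (k A : Type*) [Field k] [Ring A] [Algebra k A] :
    IsAmenableAlgebra k A ↔ ∀ S : Submodule k A, S.FG → ∀ ε : ℝ, 0 < ε →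
      ∃ V : Submodule k A, V ≠ ⊥ ∧ FiniteDimensional k V ∧
        (Module.finrank k ↥(S * V) : ℝ) < (1 + ε) * (Module.finrank k V : ℝ) := by
  constructor
  · intro h S hS ε hε
    obtain ⟨n, r, rfl⟩ := Submodule.fg_iff_exists_fin_generating_family.1 hS
    obtain ⟨V, hV, hVfin, hrV⟩ := h n r ε hε
    exact ⟨V, hV, hVfin, by rwa [Submodule.span_range_mul_eq_iSup_map_mulLeft]⟩
  · intro h n r ε hε
    obtain ⟨V, hV, hVfin, hrV⟩ := h _ (Submodule.fg_span (Set.finite_range r)) ε hε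
    exact ⟨V, hV, hVfin, by rwa [Submodule.span_range_mul_eq_iSup_map_mulLeft] at hrV⟩

theorem TensorProduct.range_mapIncl_mul_le {k A B : Type*} [CommRing k] [Ring A] [Algebra k A]
    [Ring B] [Algebra k B] (P V : Submodule k A) (Q W : Submodule k B) :
    LinearMap.range (mapIncl P Q) * LinearMap.range (mapIncl V W) ≤
      LinearMap.range (mapIncl (P * V) (Q * W)) := by
  simp only [range_mapIncl, Submodule.map₂_eq_span_image2, Submodule.span_mul_span]
  refine Submodule.span_mono ?_
  rintro _ ⟨_, ⟨p, hp, q, hq, rfl⟩, _, ⟨v, hv, w, hw, rfl⟩, rfl⟩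
  exact ⟨p * v, Submodule.mul_mem_mul hp hv, q * w, Submodule.mul_mem_mul hq hw,
    (Algebra.TensorProduct.tmul_mul_tmul p v q w).symm⟩

theorem TensorProduct.finrank_range_mapIncl {k A B : Type*} [Field k] [AddCommGroup A]
    [Module k A] [AddCommGroup B] [Module k B] (V : Submodule k A) (W : Submodule k B) :
    Module.finrank k (LinearMap.range (mapIncl V W)) =
      Module.finrank k V * Module.finrank k W := by
  rw [LinearMap.finrank_range_of_inj, Module.finrank_tensorProduct]
  exact map_injective_of_flat_flat _ _ V.injective_subtype W.injective_subtype

/-- The tensor product of two amenable `k`-algebras is amenable. -/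
theorem amenable_tensorProduct (k A B : Type*) [Field k] [Ring A] [Algebra k A]
    [Ring B] [Algebra k B] (hA : IsAmenableAlgebra k A) (hB : IsAmenableAlgebra k B) :
    IsAmenableAlgebra k (A ⊗[k] B) := by
  rw [isAmenableAlgebra_iff_fg_mul] at hA hB ⊢
  intro S hS ε hε
  obtain ⟨t, rfl⟩ := hS
  obtain ⟨P, Q, hP, hQ, ht⟩ :=
    TensorProduct.exists_finite_submodule_of_setFinite (t : Set (A ⊗[k] B)) t.finite_toSet
  have hδ : 0 < √(1 + ε) - 1 := by
    rw [sub_pos, Real.lt_sqrt zero_le_one]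
    linarith
  obtain ⟨V, hV, hVfin, hPV⟩ := hA P (Module.Finite.iff_fg.1 hP) _ hδ
  obtain ⟨W, hW, hWfin, hQW⟩ := hB Q (Module.Finite.iff_fg.1 hQ) _ hδ
  have hPVfin : FiniteDimensional k ↥(P * V) :=
    Module.Finite.iff_fg.2 ((Module.Finite.iff_fg.1 hP).mul (Module.Finite.iff_fg.1 hVfin))
  have hQWfin : FiniteDimensional k ↥(Q * W) :=
    Module.Finite.iff_fg.2 ((Module.Finite.iff_fg.1 hQ).mul (Module.Finite.iff_fg.1 hWfin))
  refine ⟨LinearMap.range (TensorProduct.mapIncl V W), ?_, inferInstance, ?_⟩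
  · intro h
    have h0 := TensorProduct.finrank_range_mapIncl V W
    rw [h, finrank_bot, eq_comm, mul_eq_zero, Submodule.finrank_eq_zero,
      Submodule.finrank_eq_zero] at h0
    exact h0.elim hV hW
  · have hle := Submodule.finrank_mono ((mul_le_mul_left (Submodule.span_le.2 ht) _).trans
      (TensorProduct.range_mapIncl_mul_le P V Q W))
    rw [TensorProduct.finrank_range_mapIncl] at hle
    rw [TensorProduct.finrank_range_mapIncl]
    rw [add_sub_cancel] at hPV hQW
    calc _ ≤ (Module.finrank k ↥(P * V) : ℝ) * Module.finrank k ↥(Q * W) := mod_cast hle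
      _ < (√(1 + ε) * Module.finrank k V) * (√(1 + ε) * Module.finrank k W) :=
        mul_lt_mul'' hPV hQW (Nat.cast_nonneg _) (Nat.cast_nonneg _)
      _ = √(1 + ε) * √(1 + ε) * (Module.finrank k V * Module.finrank k W) := by ring
      _ = _ := by rw [Real.mul_self_sqrt (by linarith), Nat.cast_mul]
end

section
/- Let k be a field and let D and E be division rings that are k-algebras, with an injective k-algebra homomorphism from D into E (so D is, up to isomorphism, a sub-division-ring of E containing k). If E is an amenable k-algebra, then D is an amenable k-algebra. Equivalently, if D is non-amenable then E is non-amenable. -/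
/-- Rank–nullity for the restriction of a linear map to a finite-dimensional subspace. -/
theorem Submodule.finrank_map_add_finrank_inf_ker {k M N : Type*} [Field k] [AddCommGroup M]
    [Module k M] [AddCommGroup N] [Module k N] (g : M →ₗ[k] N) (V : Submodule k M)
    [FiniteDimensional k V] :
    Module.finrank k (V.map g) + Module.finrank k ↥(V ⊓ LinearMap.ker g) = Module.finrank k V := by
  have h := (g.domRestrict V).finrank_range_add_finrank_ker
  have hk : (LinearMap.ker (g.domRestrict V)).map V.subtype = V ⊓ LinearMap.ker g := by
    ext x
    simp only [Submodule.mem_map, LinearMap.mem_ker, Submodule.mem_inf]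
    constructor
    · rintro ⟨y, hy, rfl⟩
      exact ⟨y.2, hy⟩
    · rintro ⟨hx, hg⟩
      exact ⟨⟨x, hx⟩, hg, rfl⟩
  rwa [LinearMap.range_domRestrict, (Submodule.equivMapOfInjective V.subtype V.injective_subtype
    (LinearMap.ker (g.domRestrict V))).finrank_eq, hk] at h

/-- If left multiplication by finitely many elements of a division ring `D` expands the dimension
of every finite-dimensional subspace of `D` by a factor `c`, then it does so in every
`D`-vector space. -/
theorem mul_finrank_le_finrank_iSup_map_lsmul {k D M : Type*} [Field k] [DivisionRing D]
    [Algebra k D] [AddCommGroup M] [Module k M] [Module D M] [IsScalarTower k D M]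
    {ι : Type*} [Finite ι] (r : ι → D) (c : ℝ)
    (hD : ∀ V : Submodule k D, FiniteDimensional k V →
      c * (Module.finrank k V : ℝ) ≤
        (Module.finrank k ↥(⨆ i, V.map (LinearMap.mulLeft k (r i))) : ℝ))
    (V : Submodule k M) [FiniteDimensional k V] :
    c * (Module.finrank k V : ℝ) ≤
      (Module.finrank k ↥(⨆ i, V.map (Algebra.lsmul k k M (r i))) : ℝ) := by
  induction hn : Module.finrank k V using Nat.strong_induction_on generalizing V with
  | _ n ih =>
  subst hn
  rcases eq_or_ne V ⊥ with rfl | hV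
  · simp
  obtain ⟨v, hv, hv0⟩ := V.exists_mem_ne_zero_of_ne_bot hV
  obtain ⟨φ, hφ⟩ : ∃ φ : M →ₗ[D] D, φ v ≠ 0 := by
    by_contra! h
    exact hv0 ((Module.Basis.ofVectorSpace D M).forall_coord_eq_zero_iff.1 fun i => h _)
  let g : M →ₗ[k] D := φ.restrictScalars k
  have : FiniteDimensional k ↥(V ⊓ LinearMap.ker g) := Submodule.finiteDimensional_inf_left _ _
  let W : Submodule k M := ⨆ i, V.map (Algebra.lsmul k k M (r i))
  have hV_rank := Submodule.finrank_map_add_finrank_inf_ker g V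
  have hW_rank := Submodule.finrank_map_add_finrank_inf_ker g W
  have hlt : V ⊓ LinearMap.ker g < V :=
    lt_of_le_of_ne inf_le_left fun h => hφ (h.ge hv).2
  have hker := ih _ (Submodule.finrank_lt_finrank_of_lt hlt) (V ⊓ LinearMap.ker g) rfl
  have hmap := hD (V.map g) inferInstance
  have hW_map : W.map g = ⨆ i, (V.map g).map (LinearMap.mulLeft k (r i)) := by
    simp only [W, Submodule.map_iSup, ← Submodule.map_comp]
    congr! 3 with i
    ext x
    simp [g]
  have hW_ker : ⨆ i, (V ⊓ LinearMap.ker g).map (Algebra.lsmul k k M (r i)) ≤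
      W ⊓ LinearMap.ker g := by
    refine iSup_le fun i => le_inf
      ((Submodule.map_mono inf_le_left).trans
        (le_iSup (fun i => V.map (Algebra.lsmul k k M (r i))) i)) ?_
    rintro _ ⟨x, ⟨-, hx⟩, rfl⟩
    have hx : φ x = 0 := hx
    simp [g, hx]
  have : FiniteDimensional k ↥(W ⊓ LinearMap.ker g) := Submodule.finiteDimensional_inf_left _ _
  have hle := Submodule.finrank_mono hW_ker
  rw [← hW_map] at hmap
  rify at hV_rank hW_rank hle
  change _ ≤ (Module.finrank k W : ℝ)
  rw [← hV_rank, ← hW_rank, mul_add]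
  linarith

/-- If `D` embeds into `E` (division rings over `k`) and `E` is amenable, then `D` is
amenable; equivalently a division ring containing a non-amenable division ring is
non-amenable. -/
theorem amenable_of_skewfield_embedding (k D E : Type*) [Field k] [DivisionRing D]
    [Algebra k D] [DivisionRing E] [Algebra k E] (f : D →ₐ[k] E)
    (hf : Function.Injective f) (hE : IsAmenableAlgebra k E) :
    IsAmenableAlgebra k D := by
  intro n r ε hε
  by_contra! h
  let _ : Module D E := Module.compHom E f.toRingHom
  have hsmul (a : D) (x : E) : a • x = f a * x := rfl
  have : IsScalarTower k D E := ⟨fun c a x => by simp [hsmul]⟩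
  obtain ⟨V, hV, hVfin, hlt⟩ := hE n (fun i => f (r i)) ε hε
  refine hlt.not_ge (mul_finrank_le_finrank_iSup_map_lsmul r (1 + ε) (fun U hU => ?_) V)
  rcases eq_or_ne U ⊥ with rfl | hU0
  · simp
  · exact h U hU0 hU
end

section
/- Let k be a field, D a division ring that is a k-algebra, α a real number, and g₁,…,g_l nonzero elements of D such that for every nonzero finite-dimensional k-subspace W ⊆ D one has dim_k(g₁W + ⋯ + g_lW) ≥ α·dim_k W. Then for every m ≥ 1 and every nonzero finite-dimensional k-subspace Z of the left D-module D^m (the direct sum of m copies of D), one has dim_k(g₁Z + ⋯ + g_lZ) ≥ α·dim_k Z, where each g_i acts on D^m diagonally by left multiplication in each coordinate. -/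
/-- Rank-nullity for a finite-dimensional subspace `Z` of the middle term of an exact sequence
`0 → A → M → C`. -/
theorem Submodule.finrank_map_add_finrank_comap_of_exact {k A M C : Type*} [Field k]
    [AddCommGroup A] [Module k A] [AddCommGroup M] [Module k M] [AddCommGroup C] [Module k C]
    {j : A →ₗ[k] M} {π : M →ₗ[k] C} (hj : Function.Injective j) (hex : Function.Exact j π)
    (Z : Submodule k M) [FiniteDimensional k Z] :
    Module.finrank k (Z.map π) + Module.finrank k (Z.comap j) = Module.finrank k Z := by
  rw [← LinearMap.finrank_range_add_finrank_ker (π.domRestrict Z), LinearMap.range_domRestrict,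
    (Submodule.equivMapOfInjective j hj _).finrank_eq,
    (Submodule.equivMapOfInjective Z.subtype Z.injective_subtype _).finrank_eq,
    LinearMap.ker_domRestrict, Submodule.map_comap_eq, Submodule.map_comap_eq,
    Submodule.range_subtype, hex.linearMap_ker_eq, inf_comm]

/-- Expansion of subspaces under a family of endomorphisms passes from the outer terms of an
exact sequence `0 → A → M → C` to the middle one. -/
theorem expansion_of_exact {k A M C ι : Type*} [Finite ι] [Field k]
    [AddCommGroup A] [Module k A] [AddCommGroup M] [Module k M] [AddCommGroup C] [Module k C]
    {j : A →ₗ[k] M} {π : M →ₗ[k] C} (hj : Function.Injective j) (hex : Function.Exact j π)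
    {a : ι → A →ₗ[k] A} {b : ι → M →ₗ[k] M} {c : ι → C →ₗ[k] C}
    (hab : ∀ i, b i ∘ₗ j = j ∘ₗ a i) (hbc : ∀ i, π ∘ₗ b i = c i ∘ₗ π) {α : ℝ}
    (hA : ∀ W : Submodule k A, FiniteDimensional k W →
      α * (Module.finrank k W : ℝ) ≤ (Module.finrank k ↥(⨆ i, W.map (a i)) : ℝ))
    (hC : ∀ W : Submodule k C, FiniteDimensional k W →
      α * (Module.finrank k W : ℝ) ≤ (Module.finrank k ↥(⨆ i, W.map (c i)) : ℝ))
    (Z : Submodule k M) [FiniteDimensional k Z] :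
    α * (Module.finrank k Z : ℝ) ≤ (Module.finrank k ↥(⨆ i, Z.map (b i)) : ℝ) := by
  have finite_comap (Y : Submodule k M) [FiniteDimensional k Y] :
      FiniteDimensional k (Y.comap j) :=
    Module.Finite.of_injective (j.restrict fun _ hx => hx : Y.comap j →ₗ[k] Y)
      fun x y hxy => Subtype.ext (hj (congrArg Subtype.val hxy))
  have hmap : (⨆ i, Z.map (b i)).map π = ⨆ i, (Z.map π).map (c i) := by
    simp_rw [Submodule.map_iSup, ← Submodule.map_comp, hbc]
  have hcomap : (⨆ i, (Z.comap j).map (a i)) ≤ (⨆ i, Z.map (b i)).comap j := by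
    refine iSup_le fun i => ?_
    rintro _ ⟨x, hx, rfl⟩
    exact Submodule.mem_iSup_of_mem i ⟨j x, hx, LinearMap.congr_fun (hab i) x⟩
  have := finite_comap Z
  have := finite_comap (⨆ i, Z.map (b i))
  have hle : (Module.finrank k ↥(⨆ i, (Z.comap j).map (a i)) : ℝ) ≤
      Module.finrank k ((⨆ i, Z.map (b i)).comap j) :=
    mod_cast Submodule.finrank_mono hcomap
  have hA' := hA (Z.comap j) inferInstance
  have hC' := hC (Z.map π) inferInstance
  rw [← Submodule.finrank_map_add_finrank_comap_of_exact hj hex Z,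
    ← Submodule.finrank_map_add_finrank_comap_of_exact hj hex (⨆ i, Z.map (b i)), hmap]
  push_cast
  linarith

/-- If nonzero elements `g₁, …, g_l` of a division ring `D` (a `k`-algebra) satisfy
`dim_k (g₁W + ⋯ + g_lW) ≥ α · dim_k W` for every nonzero finite-dimensional
`k`-subspace `W ⊆ D`, then for every `m ≥ 1` the same inequality holds for every
nonzero finite-dimensional `k`-subspace `Z` of the left `D`-module `D^m`, with the `gᵢ`
acting diagonally by left multiplication in each coordinate. -/
theorem expansion_extends_to_free_modules (k D : Type*) [Field k] [DivisionRing D]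
    [Algebra k D] (l : ℕ) (g : Fin l → D) (hg : ∀ i, g i ≠ 0) (α : ℝ)
    (h : ∀ W : Submodule k D, W ≠ ⊥ → FiniteDimensional k W →
      α * (Module.finrank k W : ℝ) ≤
        (Module.finrank k ↥(⨆ i, W.map (LinearMap.mulLeft k (g i))) : ℝ))
    (m : ℕ) (hm : 1 ≤ m) (Z : Submodule k (Fin m → D)) (hZ : Z ≠ ⊥)
    (hZfin : FiniteDimensional k Z) :
    α * (Module.finrank k Z : ℝ) ≤
      (Module.finrank k
        ↥(⨆ i, Z.map ((LinearMap.mulLeft k (g i)).compLeft (Fin m))) : ℝ) := by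
  have h' (W : Submodule k D) (hW : FiniteDimensional k W) :
      α * (Module.finrank k W : ℝ) ≤
        (Module.finrank k ↥(⨆ i, W.map (LinearMap.mulLeft k (g i))) : ℝ) := by
    obtain rfl | hbot := eq_or_ne W ⊥
    · simp
    · exact h W hbot hW
  clear hZ hm
  induction m with
  | zero => simp [Module.finrank_zero_of_subsingleton]
  | succ n ih =>
    refine expansion_of_exact (j := LinearMap.single k (fun _ : Fin (n + 1) => D) 0)
      (π := LinearMap.funLeft k D Fin.succ) (Pi.single_injective (M := fun _ => D) 0) (fun x => ?_)
      (a := fun i => LinearMap.mulLeft k (g i))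
      (c := fun i => (LinearMap.mulLeft k (g i)).compLeft (Fin n))
      (fun i => ?_) (fun i => rfl) h' (fun W hW => ih W hW) Z
    · constructor
      · intro hx
        refine ⟨x 0, funext fun i => ?_⟩
        cases i using Fin.cases with
        | zero => simp
        | succ i => simpa using (congrFun hx i).symm
      · rintro ⟨d, rfl⟩
        ext i
        simp [LinearMap.funLeft_apply]
    · refine LinearMap.ext fun d => funext fun t => ?_
      cases t using Fin.cases <;> simp
end

section
/- Let Γ be a countable group, H a complex Hilbert space, and ρ : Γ → U(H) a unitary representation of Γ on H. Suppose the induced linear action of Γ on H is algebraically amenable. Then the representation is amenable in the sense of Bekka: there exists a linear functional τ : B(H) → ℂ on the algebra of bounded linear operators on H such that |τ(A)| ≤ ‖A‖ for all A ∈ B(H), τ(Id) = 1, and τ(ρ(g)⁻¹ ∘ A ∘ ρ(g)) = τ(A) for every A ∈ B(H) and every g ∈ Γ. -/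
/-- A linear action `ρ` of a group `Γ` on a complex vector space `V` is *algebraically
amenable* if for every finite list `g₁, …, g_m` of elements of `Γ` and every `ε > 0`
there is a nonzero finite-dimensional subspace `W ⊆ V` with
`dim_ℂ (g₁W + ⋯ + g_mW) < (1 + ε) · dim_ℂ W`. -/
def AlgebraicallyAmenableAction {Γ V : Type*} [Group Γ] [AddCommGroup V] [Module ℂ V]
    (ρ : Γ → (V →ₗ[ℂ] V)) : Prop :=
  ∀ (m : ℕ) (g : Fin m → Γ) (ε : ℝ), 0 < ε →
    ∃ W : Submodule ℂ V, W ≠ ⊥ ∧ FiniteDimensional ℂ W ∧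
      (Module.finrank ℂ ↥(⨆ i, W.map (ρ (g i))) : ℝ) <
        (1 + ε) * (Module.finrank ℂ W : ℝ)

open scoped InnerProductSpace Topology

/-- The trace of the compression of a bounded operator `A` to a finite-dimensional subspace `U`
differs from the sum of the diagonal coefficients of `A` along an orthonormal family in `U` by at
most `‖A‖` times the codimension of the span of the family. -/
theorem norm_trace_compression_sub_sum_inner_le {H : Type*} [NormedAddCommGroup H]
    [InnerProductSpace ℂ H] (U : Submodule ℂ H) [FiniteDimensional ℂ U] {d k : ℕ}
    (hU : Module.finrank ℂ U = d + k) {v : Fin d → H} (hv : Orthonormal ℂ v)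
    (hvU : ∀ i, v i ∈ U) (A : H →L[ℂ] H) :
    ‖LinearMap.trace ℂ U
        ((U.orthogonalProjectionOnto ∘L A ∘L U.subtypeL : U →L[ℂ] U) : U →ₗ[ℂ] U) -
      ∑ i, ⟪v i, A (v i)⟫_ℂ‖ ≤ k * ‖A‖ := by
  let v' : Fin d ⊕ Fin k → U := Sum.elim (fun i => ⟨v i, hvU i⟩) 0
  have hv' : Orthonormal ℂ ((Set.range (Sum.inl : Fin d → Fin d ⊕ Fin k)).domRestrict v') := by
    refine ⟨?_, ?_⟩
    · rintro ⟨_, i, rfl⟩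
      exact hv.1 i
    · rintro ⟨_, i, rfl⟩ ⟨_, j, rfl⟩ hij
      exact hv.2 fun h => hij (by simp [h])
  obtain ⟨b, hb⟩ := hv'.exists_orthonormalBasis_extension_of_card_eq (by simp [hU])
  have hbl (i : Fin d) : (b (Sum.inl i) : H) = v i := by rw [hb _ ⟨i, rfl⟩]; rfl
  rw [LinearMap.trace_eq_sum_inner _ b, Fintype.sum_sum_type]
  simp only [ContinuousLinearMap.coe_coe, ContinuousLinearMap.comp_apply,
    Submodule.inner_orthogonalProjectionOnto_eq_of_mem_left, Submodule.subtypeL_apply, hbl,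
    add_sub_cancel_left]
  refine (norm_sum_le_of_le _ (n := fun _ => ‖A‖) fun i _ => ?_).trans (by simp)
  have hn : ‖(b (Sum.inr i) : H)‖ = 1 := b.orthonormal.1 _
  refine (norm_inner_le_norm _ _).trans ?_
  simpa [hn] using A.le_opNorm (b (Sum.inr i) : H)

/-- An algebraically amenable unitary action has, for every finite set of group elements and every
`ε > 0`, a state on the bounded operators which is invariant up to `ε` under conjugation by these
elements. -/
theorem exists_almost_invariant_state {Γ H : Type*} [Group Γ]
    [NormedAddCommGroup H] [InnerProductSpace ℂ H] [CompleteSpace H]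
    (ρ : Γ →* (H →L[ℂ] H)) (hρ : ∀ g : Γ, ρ g ∈ unitary (H →L[ℂ] H))
    (hamen : AlgebraicallyAmenableAction (fun g : Γ => ((ρ g : H →L[ℂ] H) : H →ₗ[ℂ] H)))
    (F : Finset Γ) {ε : ℝ} (hε : 0 < ε) :
    ∃ φ : (H →L[ℂ] H) →ₗ[ℂ] ℂ, (∀ A : H →L[ℂ] H, ‖φ A‖ ≤ ‖A‖) ∧ φ 1 = 1 ∧
      ∀ g ∈ F, ∀ A : H →L[ℂ] H, ‖φ (ρ g⁻¹ * A * ρ g) - φ A‖ ≤ ε * ‖A‖ := by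
  classical
  let e := (insert 1 F).equivFin
  obtain ⟨W, hW, hfin, hlt⟩ := hamen _ (fun i => (e.symm i : Γ)) (ε / 2) (by positivity)
  set U : Submodule ℂ H :=
    ⨆ i, W.map ((ρ (e.symm i : Γ) : H →L[ℂ] H) : H →ₗ[ℂ] H) with hUdef
  have hWU (g : Γ) (hg : g ∈ insert 1 F) (w : H) (hw : w ∈ W) : ρ g w ∈ U := by
    have h : W.map ((ρ g : H →L[ℂ] H) : H →ₗ[ℂ] H) ≤ U := by
      have := le_iSup (fun i => W.map ((ρ (e.symm i : Γ) : H →L[ℂ] H) : H →ₗ[ℂ] H)) (e ⟨g, hg⟩)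
      simpa only [Equiv.symm_apply_apply] using this
    exact h ⟨w, hw, rfl⟩
  have hUfin : FiniteDimensional ℂ U := by rw [hUdef]; infer_instance
  have hle : W ≤ U := fun w hw => by simpa using hWU 1 (by simp) w hw
  obtain ⟨k, hk⟩ := Nat.exists_eq_add_of_le (Submodule.finrank_mono hle)
  set d := Module.finrank ℂ W
  have hdpos : 0 < d := Nat.pos_of_ne_zero fun h => hW (Submodule.finrank_eq_zero.1 h)
  have hdR : (0 : ℝ) < d := by exact_mod_cast hdpos
  have hkε : (k : ℝ) ≤ ε / 2 * d := by
    rw [hk] at hlt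
    push_cast at hlt
    linarith
  let b := stdOrthonormalBasis ℂ W
  let v : Fin d → H := fun i => b i
  have hv : Orthonormal ℂ v := b.orthonormal.comp_linearIsometry W.subtypeₗᵢ
  let φ : (H →L[ℂ] H) →ₗ[ℂ] ℂ :=
    { toFun := fun A => (d : ℂ)⁻¹ * ∑ i, ⟪v i, A (v i)⟫_ℂ
      map_add' := fun A B => by simp [Finset.sum_add_distrib, mul_add]
      map_smul' := fun c A => by
        simp only [smul_apply, inner_smul_right, ← Finset.mul_sum,
          RingHom.id_apply, smul_eq_mul]
        ring }
  have hφ (A : H →L[ℂ] H) : φ A = (d : ℂ)⁻¹ * ∑ i, ⟪v i, A (v i)⟫_ℂ := rfl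
  have hdC : (d : ℂ) ≠ 0 := by exact_mod_cast hdpos.ne'
  refine ⟨φ, fun A => ?_, ?_, fun g hg A => ?_⟩
  · have h : ‖∑ i, ⟪v i, A (v i)⟫_ℂ‖ ≤ d * ‖A‖ := by
      refine (norm_sum_le_of_le _ (n := fun _ => ‖A‖) fun i _ => ?_).trans (by simp)
      refine (norm_inner_le_norm _ _).trans ?_
      simpa [hv.1 i] using A.le_opNorm (v i)
    rw [hφ, norm_mul, norm_inv, Complex.norm_natCast, inv_mul_le_iff₀ hdR]
    exact h
  · simp [hφ, inner_self_eq_norm_sq_to_K, hv.1, hdC]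
  · have hconj (i : Fin d) :
        ⟪v i, (ρ g⁻¹ * A * ρ g) (v i)⟫_ℂ = ⟪ρ g (v i), A (ρ g (v i))⟫_ℂ := by
      rw [← ContinuousLinearMap.inner_map_map_of_mem_unitary (hρ g)]
      simp only [← mul_apply_eq_comp, ← mul_assoc, ← map_mul, mul_inv_cancel,
        map_one, one_mul]
    have hgv : Orthonormal ℂ fun i => ρ g (v i) := by
      simpa only [orthonormal_iff_ite,
        ContinuousLinearMap.inner_map_map_of_mem_unitary (hρ g)] using hv
    have h₁ := norm_trace_compression_sub_sum_inner_le U hk hv (fun i => hle (b i).2) A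
    have h₂ := norm_trace_compression_sub_sum_inner_le U hk hgv
      (fun i => hWU g (Finset.mem_insert_of_mem hg) _ (b i).2) A
    have h₃ := (norm_sub_le _ _).trans (add_le_add h₁ h₂)
    rw [sub_sub_sub_cancel_left] at h₃
    rw [hφ, hφ, ← mul_sub, norm_mul, norm_inv, Complex.norm_natCast, inv_mul_le_iff₀ hdR]
    simp only [hconj]
    refine h₃.trans ?_
    nlinarith [mul_le_mul_of_nonneg_right hkε (norm_nonneg A)]

/-- A unitary representation of a countable group on a complex Hilbert space which is
algebraically amenable is amenable in the sense of Bekka: there is a norm-bounded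
linear functional `τ` on `B(H)` with `τ(Id) = 1` which is invariant under conjugation
by the representation. -/
theorem bekka_amenable_of_algebraically_amenable (Γ H : Type*) [Group Γ] [Countable Γ]
    [NormedAddCommGroup H] [InnerProductSpace ℂ H] [CompleteSpace H]
    (ρ : Γ →* (H →L[ℂ] H)) (hρ : ∀ g : Γ, ρ g ∈ unitary (H →L[ℂ] H))
    (hamen : AlgebraicallyAmenableAction (fun g : Γ => ((ρ g : H →L[ℂ] H) : H →ₗ[ℂ] H))) :
    ∃ τ : (H →L[ℂ] H) →ₗ[ℂ] ℂ, (∀ A : H →L[ℂ] H, ‖τ A‖ ≤ ‖A‖) ∧ τ 1 = 1 ∧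
      ∀ (g : Γ) (A : H →L[ℂ] H), τ (ρ g⁻¹ * A * ρ g) = τ A := by
  classical
  choose φ hnorm hone hinv using fun p : Finset Γ × ℕ =>
    exists_almost_invariant_state ρ hρ hamen p.1 (Nat.one_div_pos_of_nat (α := ℝ) (n := p.2))
  let l : Ultrafilter (Finset Γ × ℕ) := Ultrafilter.of Filter.atTop
  have hl : (l : Filter (Finset Γ × ℕ)) ≤ Filter.atTop := Ultrafilter.of_le _
  have hlim (A : H →L[ℂ] H) : ∃ z : ℂ, ‖z‖ ≤ ‖A‖ ∧ Filter.Tendsto (fun p => φ p A) l (𝓝 z) := by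
    obtain ⟨z, hz, hzl⟩ := (isCompact_closedBall (0 : ℂ) ‖A‖).ultrafilter_le_nhds
      (l.map fun p => φ p A)
      (Filter.le_principal_iff.2 (Filter.mem_map.2 (Filter.univ_mem' fun p => by simp [hnorm])))
    exact ⟨z, by simpa using hz, hzl⟩
  choose τ hτ hτlim using hlim
  refine ⟨⟨⟨τ, fun A B => ?_⟩, fun c A => ?_⟩, hτ, ?_, fun g A => ?_⟩
  · exact tendsto_nhds_unique (hτlim _) (by simpa using (hτlim A).add (hτlim B))
  · exact tendsto_nhds_unique (hτlim _) (by simpa using (hτlim A).const_mul c)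
  · exact tendsto_nhds_unique (hτlim 1) (by simp [hone])
  · have hzero : Filter.Tendsto (fun p : Finset Γ × ℕ => 1 / ((p.2 : ℝ) + 1) * ‖A‖) l (𝓝 0) := by
      have hsnd : Filter.Tendsto (Prod.snd : Finset Γ × ℕ → ℕ) l Filter.atTop := by
        refine Filter.Tendsto.mono_left ?_ hl
        rw [← Filter.prod_atTop_atTop_eq]
        exact Filter.tendsto_snd
      simpa using (tendsto_one_div_add_atTop_nhds_zero_nat.comp hsnd).mul_const ‖A‖
    have hev : ∀ᶠ p in (l : Filter (Finset Γ × ℕ)),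
        ‖φ p (ρ g⁻¹ * A * ρ g) - φ p A‖ ≤ 1 / ((p.2 : ℝ) + 1) * ‖A‖ := by
      filter_upwards [hl (Filter.eventually_ge_atTop (({g} : Finset Γ), 0))] with p hp
      exact hinv p g (hp.1 (Finset.mem_singleton_self g)) A
    exact sub_eq_zero.1 <| tendsto_nhds_unique ((hτlim _).sub (hτlim A))
      (squeeze_zero_norm' hev hzero)
end

section
/- Let Γ be a group, k a field, and suppose Γ satisfies the Følner condition: for every finite subset S ⊆ Γ and every real ε > 0 there exists a finite nonempty subset F ⊆ Γ with |S·F ∪ F| < (1+ε)·|F|, where S·F = {sf : s ∈ S, f ∈ F}. Then the group algebra k[Γ] (the monoid algebra of Γ over k) is an amenable k-algebra. -/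
open scoped Pointwise

open Module

namespace MonoidAlgebra

variable (k : Type*) [Field k]

theorem finiteDimensional_supported {M : Type*} (F : Finset M) :
    FiniteDimensional k (supported k k (F : Set M)) :=
  Module.Finite.equiv (supportedEquivFinsupp (R := k) (S := k) (F : Set M)).symm

theorem finrank_supported {M : Type*} (F : Finset M) :
    finrank k (supported k k (F : Set M)) = F.card := by
  rw [(supportedEquivFinsupp (R := k) (S := k) (F : Set M)).finrank_eq]
  simp

variable {k}

theorem map_mulLeft_supported_le {M : Type*} [Monoid M] [DecidableEq M] {S F : Finset M}
    {r : MonoidAlgebra k M} (hr : r.coeff.support ⊆ S) :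
    (supported k k (F : Set M)).map (LinearMap.mulLeft k r) ≤
      supported k k ((S * F : Finset M) : Set M) := by
  rintro _ ⟨x, hx, rfl⟩
  rw [SetLike.mem_coe, mem_supported, Finset.coe_subset] at hx
  rw [mem_supported, Finset.coe_subset]
  exact (support_coeff_mul_subset r x).trans (Finset.mul_subset_mul hr hx)

end MonoidAlgebra

/-- If a group `Γ` satisfies the Følner condition, then its group algebra `k[Γ]` is an
amenable `k`-algebra. -/
theorem monoidAlgebra_amenable_of_folner (k Γ : Type*) [Field k] [Group Γ] [DecidableEq Γ]
    (hFolner : ∀ (S : Finset Γ) (ε : ℝ), 0 < ε → ∃ F : Finset Γ, F.Nonempty ∧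
      ((S * F ∪ F).card : ℝ) < (1 + ε) * (F.card : ℝ)) :
    IsAmenableAlgebra k (MonoidAlgebra k Γ) := by
  intro n r ε hε
  set S : Finset Γ := Finset.univ.biUnion fun i ↦ (r i).coeff.support
  obtain ⟨F, hF, hcard⟩ := hFolner S ε hε
  have := MonoidAlgebra.finiteDimensional_supported k (S * F)
  refine ⟨MonoidAlgebra.supported k k (F : Set Γ), ?_,
    MonoidAlgebra.finiteDimensional_supported k F, ?_⟩
  · intro h
    have hrank := MonoidAlgebra.finrank_supported k F
    rw [h, finrank_bot] at hrank
    exact hF.card_pos.ne hrank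
  · have hle : ⨆ i, (MonoidAlgebra.supported k k (F : Set Γ)).map (LinearMap.mulLeft k (r i)) ≤
        MonoidAlgebra.supported k k ((S * F : Finset Γ) : Set Γ) :=
      iSup_le fun i ↦ MonoidAlgebra.map_mulLeft_supported_le
        (Finset.subset_biUnion_of_mem (fun i ↦ (r i).coeff.support) (Finset.mem_univ i))
    have hrank := Submodule.finrank_mono hle
    rw [MonoidAlgebra.finrank_supported] at hrank ⊢
    refine lt_of_le_of_lt ?_ hcard
    exact_mod_cast hrank.trans (Finset.card_le_card Finset.subset_union_left)
end

section
/- Let Γ be a countable group and suppose the complex group algebra ℂ[Γ] is an amenable ℂ-algebra. Then Γ is amenable, in the sense that there exists a linear functional m : ℓ^∞(Γ; ℂ) → ℂ with |m(f)| ≤ ‖f‖_∞ for all f, m(1) = 1 (where 1 is the constant one function), and m(γ·f) = m(f) for every γ ∈ Γ and f ∈ ℓ^∞(Γ; ℂ), where (γ·f)(δ) = f(γ⁻¹δ). -/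
open scoped ENNReal

theorem HilbertBasis.exists_linearIsometryEquiv_perm {ι 𝕜 E : Type*} [RCLike 𝕜]
    [NormedAddCommGroup E] [InnerProductSpace 𝕜 E] [CompleteSpace E] (b : HilbertBasis ι 𝕜 E)
    (σ : Equiv.Perm ι) : ∃ T : E ≃ₗᵢ[𝕜] E, ∀ i, T (b i) = b (σ i) := by
  classical
  let b' : HilbertBasis ι 𝕜 E := HilbertBasis.mk (b.orthonormal.comp σ σ.injective) (by
    rw [EquivLike.range_comp, b.dense_span])
  refine ⟨b.repr.trans b'.repr.symm, fun i => ?_⟩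
  rw [LinearIsometryEquiv.trans_apply, b.repr_self, b'.repr_symm_single]
  simp [b']

section
variable {ι H : Type*} [NormedAddCommGroup H] [InnerProductSpace ℂ H]

theorem HilbertBasis.hasSum_norm_sq_starProjection (b : HilbertBasis ι ℂ H) (U : Submodule ℂ H)
    [FiniteDimensional ℂ U] :
    HasSum (fun i => ‖U.starProjection (b i)‖ ^ 2) (Module.finrank ℂ U : ℝ) := by
  let u := stdOrthonormalBasis ℂ U
  have h1 : ∀ i, ‖U.starProjection (b i)‖ ^ 2 = ∑ j, ‖inner ℂ (u j : H) (b i)‖ ^ 2 := by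
    intro i
    rw [Submodule.starProjection_apply, Submodule.norm_coe, ← u.sum_sq_norm_inner_right]
    simp
  have h2 : ∀ j, HasSum (fun i => ‖inner ℂ (u j : H) (b i)‖ ^ 2) (1 : ℝ) := by
    intro j
    have h := b.hasSum_inner_mul_inner (u j : H) (u j : H)
    have h3 : inner ℂ (u j : H) (u j : H) = ((1 : ℝ) : ℂ) := by
      rw [inner_self_eq_norm_sq_to_K, Submodule.norm_coe, u.norm_eq_one]; simp
    rw [h3] at h
    rw [← Complex.hasSum_ofReal]
    convert! h using 2
    rw [← inner_conj_symm (b _), RCLike.mul_conj]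
    simp
  simp_rw [h1]
  have := hasSum_sum (s := Finset.univ) fun j _ => h2 j
  simpa using this

theorem Submodule.norm_starProjection_apply_mono {U W : Submodule ℂ H}
    [U.HasOrthogonalProjection] [W.HasOrthogonalProjection] (hUW : U ≤ W) (x : H) :
    ‖U.starProjection x‖ ≤ ‖W.starProjection x‖ := by
  rw [← Submodule.starProjection_comp_starProjection_of_le hUW]
  exact U.norm_starProjection_apply_le _
end

theorem Summable.ofReal_mul_lp {ι : Type*} {w : ι → ℝ} (hw : Summable w)
    (f : lp (fun _ : ι => ℂ) ∞) : Summable fun i => (w i : ℂ) * f i := by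
  refine Summable.of_norm_bounded (hw.abs.mul_right ‖f‖) fun i => ?_
  rw [norm_mul, Complex.norm_real, Real.norm_eq_abs]
  gcongr
  exact lp.norm_apply_le_norm ENNReal.top_ne_zero f i

/-- The linear functional `f ↦ ∑ i, w i * f i` on `ℓ^∞` attached to a summable weight `w`. -/
noncomputable def weightedSum {ι : Type*} (w : ι → ℝ) (hw : Summable w) :
    lp (fun _ : ι => ℂ) ∞ →ₗ[ℂ] ℂ where
  toFun f := ∑' i, (w i : ℂ) * f i
  map_add' f g := by
    rw [← (hw.ofReal_mul_lp f).tsum_add (hw.ofReal_mul_lp g)]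
    simp [mul_add]
  map_smul' c f := by
    rw [RingHom.id_apply, smul_eq_mul, ← tsum_mul_left]
    simp [mul_left_comm]

theorem weightedSum_apply {ι : Type*} {w : ι → ℝ} (hw : Summable w)
    (f : lp (fun _ : ι => ℂ) ∞) : weightedSum w hw f = ∑' i, (w i : ℂ) * f i := rfl

theorem norm_weightedSum_le {ι : Type*} {w v : ι → ℝ} {d : ℝ} (hw : Summable w)
    (hv : HasSum v d) (hwv : ∀ i, |w i| ≤ v i) (f : lp (fun _ : ι => ℂ) ∞) :
    ‖weightedSum w hw f‖ ≤ d * ‖f‖ := by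
  refine tsum_of_norm_bounded (hv.mul_right ‖f‖) fun i => ?_
  rw [norm_mul, Complex.norm_real, Real.norm_eq_abs]
  exact mul_le_mul (hwv i) (lp.norm_apply_le_norm ENNReal.top_ne_zero f i) (norm_nonneg _)
    ((abs_nonneg _).trans (hwv i))

/-- An almost invariant weight yields an almost invariant mean. -/
theorem norm_weightedSum_translate_sub_le {Γ : Type*} [Group Γ] {w u : Γ → ℝ} {d D : ℝ}
    (hw : HasSum w d) (hu : HasSum u D) (hwu : ∀ δ, w δ ≤ u δ) (γ : Γ)
    (hγ : ∀ δ, w (γ⁻¹ * δ) ≤ u δ) (f f' : lp (fun _ : Γ => ℂ) ∞)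
    (hf : ∀ δ : Γ, f' δ = f (γ⁻¹ * δ)) :
    ‖weightedSum w hw.summable f' - weightedSum w hw.summable f‖ ≤ 2 * (D - d) * ‖f'‖ := by
  have hw' : HasSum (fun δ => w (γ⁻¹ * δ)) d := (Equiv.mulLeft γ⁻¹).hasSum_iff.2 hw
  have key : weightedSum w hw.summable f' - weightedSum w hw.summable f =
      weightedSum (fun δ => w δ - w (γ⁻¹ * δ)) (hw.summable.sub hw'.summable) f' := by
    have h1 : weightedSum w hw.summable f = weightedSum _ hw'.summable f' := by
      simp_rw [weightedSum_apply, hf]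
      exact ((Equiv.mulLeft γ⁻¹).tsum_eq fun δ => (w δ : ℂ) * f δ).symm
    rw [h1, weightedSum_apply, weightedSum_apply, weightedSum_apply,
      ← (hw.summable.ofReal_mul_lp f').tsum_sub (hw'.summable.ofReal_mul_lp f')]
    simp [sub_mul]
  rw [key]
  refine norm_weightedSum_le _ (v := fun δ => (u δ - w δ) + (u δ - w (γ⁻¹ * δ))) ?_ ?_ f'
  · convert! (hu.sub hw).add (hu.sub hw') using 1
    ring
  · intro δ
    have := hwu δ
    have := hγ δ
    rw [abs_le]
    constructor <;> linarith

theorem exists_almost_invariant_mean {Γ : Type*} [Group Γ]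
    (h : IsAmenableAlgebra ℂ (MonoidAlgebra ℂ Γ)) (s : Finset Γ) {ε : ℝ} (hε : 0 < ε) :
    ∃ m : lp (fun _ : Γ => ℂ) ∞ →ₗ[ℂ] ℂ,
      (∀ f : lp (fun _ : Γ => ℂ) ∞, ‖m f‖ ≤ ‖f‖) ∧ m 1 = 1 ∧
      ∀ γ ∈ s, ∀ f f' : lp (fun _ : Γ => ℂ) ∞,
        (∀ δ : Γ, f' δ = f (γ⁻¹ * δ)) → ‖m f' - m f‖ ≤ ε * ‖f'‖ := by
  classical
  let H := lp (fun _ : Γ => ℂ) 2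
  let b : HilbertBasis Γ ℂ H := .ofRepr (.refl ℂ H)
  let L : MonoidAlgebra ℂ Γ →ₗ[ℂ] H :=
    Finsupp.linearCombination ℂ b ∘ₗ (MonoidAlgebra.coeffLinearEquiv ℂ).toLinearMap
  have hL : Function.Injective L :=
    Function.Injective.comp (g := Finsupp.linearCombination ℂ b) b.orthonormal.linearIndependent
      (MonoidAlgebra.coeffLinearEquiv ℂ).injective
  have hLsingle : ∀ δ c, L (MonoidAlgebra.single δ c) = c • b δ := fun δ c => by simp [L]
  have hrank : ∀ X : Submodule ℂ (MonoidAlgebra ℂ Γ),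
      Module.finrank ℂ (X.map L) = Module.finrank ℂ X := fun X =>
    (Submodule.equivMapOfInjective L hL X).finrank_eq.symm
  let t := insert 1 s
  obtain ⟨V, hV0, hVfin, hV⟩ := h t.card
    (fun i => MonoidAlgebra.single (t.equivFin.symm i : Γ) 1) (ε / 2) (half_pos hε)
  let W := ⨆ i, V.map (LinearMap.mulLeft ℂ (MonoidAlgebra.single (t.equivFin.symm i : Γ) (1 : ℂ)))
  have hmem : ∀ γ ∈ t, V.map (LinearMap.mulLeft ℂ (MonoidAlgebra.single γ 1)) ≤ W := by
    intro γ hγ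
    convert! le_iSup (fun i => V.map (LinearMap.mulLeft ℂ
      (MonoidAlgebra.single (t.equivFin.symm i : Γ) (1 : ℂ)))) (t.equivFin ⟨γ, hγ⟩) using 1
    simp
  have hVW : V ≤ W := by
    convert! hmem 1 (Finset.mem_insert_self _ _) using 1
    rw [← MonoidAlgebra.one_def, LinearMap.mulLeft_one, Submodule.map_id]
  have hUW := Submodule.map_mono (f := L) hVW
  have hsumU := b.hasSum_norm_sq_starProjection (V.map L)
  have hsumW := b.hasSum_norm_sq_starProjection (W.map L)
  rw [hrank] at hsumU hsumW
  set d : ℝ := (Module.finrank ℂ V : ℝ)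
  have hdpos : 0 < d := by
    have : Nontrivial V := Submodule.nontrivial_iff_ne_bot.2 hV0
    exact Nat.cast_pos.2 Module.finrank_pos
  have hsumU' := hsumU.mul_left d⁻¹
  have hsumW' := hsumW.mul_left d⁻¹
  rw [inv_mul_cancel₀ hdpos.ne'] at hsumU'
  refine ⟨weightedSum _ hsumU'.summable, fun f => ?_, ?_, fun γ hγ f f' hf => ?_⟩
  · rw [← one_mul ‖f‖]
    exact norm_weightedSum_le _ hsumU' (fun δ => (abs_of_nonneg (by positivity)).le) f
  · rw [weightedSum_apply]
    simp only [lp.infty_coeFn_one, Pi.one_apply, mul_one]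
    exact_mod_cast hsumU'.tsum_eq
  · obtain ⟨T, hT⟩ := b.exists_linearIsometryEquiv_perm (Equiv.mulLeft γ)
    have hTL : T.toLinearEquiv.toLinearMap ∘ₗ L =
        L ∘ₗ LinearMap.mulLeft ℂ (MonoidAlgebra.single γ 1) := by
      ext δ : 2
      simp [hLsingle, hT]
    have hTU : (V.map L).map T.toLinearEquiv.toLinearMap ≤ W.map L := by
      rw [← Submodule.map_comp, hTL, Submodule.map_comp]
      exact Submodule.map_mono (hmem γ (Finset.mem_insert_of_mem hγ))
    have hTb : ∀ δ, T.symm (b δ) = b (γ⁻¹ * δ) := fun δ => by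
      rw [LinearIsometryEquiv.symm_apply_eq, hT]; simp
    refine (norm_weightedSum_translate_sub_le hsumU' hsumW' (fun δ => ?_) γ (fun δ => ?_)
      f f' hf).trans ?_
    · gcongr
      exact Submodule.norm_starProjection_apply_mono hUW _
    · rw [← hTb, ← T.norm_map, ← Submodule.starProjection_map_apply]
      gcongr
      exact Submodule.norm_starProjection_apply_mono hTU _
    · gcongr
      have : d⁻¹ * (Module.finrank ℂ W : ℝ) ≤ d⁻¹ * ((1 + ε / 2) * d) := by gcongr
      have : d⁻¹ * ((1 + ε / 2) * d) = 1 + ε / 2 := by field_simp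
      linarith

theorem exists_invariant_mean_of_almost_invariant {Γ : Type*} [Group Γ]
    (h : ∀ (s : Finset Γ) (ε : ℝ), 0 < ε → ∃ m : lp (fun _ : Γ => ℂ) ∞ →ₗ[ℂ] ℂ,
      (∀ f : lp (fun _ : Γ => ℂ) ∞, ‖m f‖ ≤ ‖f‖) ∧ m 1 = 1 ∧
      ∀ γ ∈ s, ∀ f f' : lp (fun _ : Γ => ℂ) ∞,
        (∀ δ : Γ, f' δ = f (γ⁻¹ * δ)) → ‖m f' - m f‖ ≤ ε * ‖f'‖) :
    ∃ m : lp (fun _ : Γ => ℂ) ∞ →ₗ[ℂ] ℂ,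
      (∀ f : lp (fun _ : Γ => ℂ) ∞, ‖m f‖ ≤ ‖f‖) ∧
      m 1 = 1 ∧
      ∀ (γ : Γ) (f f' : lp (fun _ : Γ => ℂ) ∞),
        (∀ δ : Γ, f' δ = f (γ⁻¹ * δ)) → m f' = m f := by
  classical
  choose m hbound hone hinv using fun p : Finset Γ × ℕ =>
    h p.1 (1 / ((p.2 : ℝ) + 1)) Nat.one_div_pos_of_nat
  let 𝒰 := Ultrafilter.of (Filter.atTop : Filter (Finset Γ × ℕ))
  have hlim : ∀ f, ∃ z : ℂ, Filter.Tendsto (fun p => m p f) 𝒰 (nhds z) := by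
    intro f
    obtain ⟨z, -, hz⟩ := (isCompact_closedBall (0 : ℂ) ‖f‖).ultrafilter_le_nhds'
      (𝒰.map fun p => m p f) (Filter.mem_map.2 (Filter.univ_mem' fun p => by simpa using hbound p f))
    exact ⟨z, hz⟩
  choose M hM using hlim
  refine ⟨{ toFun := M, map_add' := fun f g => ?_, map_smul' := fun c f => ?_ },
    fun f => ?_, ?_, fun γ f f' hf => ?_⟩
  · refine tendsto_nhds_unique (hM (f + g)) ?_
    simpa only [map_add] using (hM f).add (hM g)
  · refine tendsto_nhds_unique (hM (c • f)) ?_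
    simpa only [map_smul, RingHom.id_apply] using (hM f).const_smul c
  · exact le_of_tendsto (hM f).norm (.of_forall fun p => hbound p f)
  · refine tendsto_nhds_unique (hM 1) ?_
    simpa only [hone] using tendsto_const_nhds
  · rw [← sub_eq_zero]
    refine tendsto_nhds_unique ((hM f').sub (hM f)) (squeeze_zero_norm'
      (a := fun p : Finset Γ × ℕ => 1 / ((p.2 : ℝ) + 1) * ‖f'‖) ?_ ?_)
    · refine Ultrafilter.of_le _ ?_
      filter_upwards [Filter.mem_atTop ({γ}, 0)] with p hp
      exact hinv p γ (hp.1 (Finset.mem_singleton_self γ)) f f' hf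
    · refine Filter.Tendsto.mono_left ?_ (Ultrafilter.of_le _)
      rw [← zero_mul ‖f'‖, ← Filter.prod_atTop_atTop_eq]
      exact (tendsto_one_div_add_atTop_nhds_zero_nat.comp Filter.tendsto_snd).mul_const _

/-- If the complex group algebra `ℂ[Γ]` of a countable group `Γ` is an amenable
`ℂ`-algebra, then `Γ` admits an invariant mean on `ℓ^∞(Γ; ℂ)`: a norm-bounded linear
functional `m` with `m(1) = 1` which is invariant under left translation,
`m(γ·f) = m(f)` where `(γ·f)(δ) = f(γ⁻¹δ)`. -/
theorem group_amenable_of_groupAlgebra_amenable (Γ : Type*) [Group Γ] [Countable Γ]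
    (h : IsAmenableAlgebra ℂ (MonoidAlgebra ℂ Γ)) :
    ∃ m : lp (fun _ : Γ => ℂ) ∞ →ₗ[ℂ] ℂ,
      (∀ f : lp (fun _ : Γ => ℂ) ∞, ‖m f‖ ≤ ‖f‖) ∧
      m 1 = 1 ∧
      ∀ (γ : Γ) (f f' : lp (fun _ : Γ => ℂ) ∞),
        (∀ δ : Γ, f' δ = f (γ⁻¹ * δ)) → m f' = m f := by
  exact exists_invariant_mean_of_almost_invariant fun s ε hε =>
    exists_almost_invariant_mean h s hε
end

section
/- Let k be a field and A a nontrivial unital associative k-algebra that is amenable. Then A has the invariant basis number property: for natural numbers m and n, if the free left A-modules A^m and A^n are isomorphic as A-modules, then m = n. -/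
/-- The matrix of an `A`-linear isomorphism between free left modules has a left inverse, given by
the matrix of the inverse isomorphism. -/
theorem toMatrix_symm_mul_toMatrix {A : Type*} [Ring A] {m n : ℕ}
    (e : (Fin m → A) ≃ₗ[A] (Fin n → A)) :
    (Matrix.of fun j => e.symm (Pi.single j 1)) * (Matrix.of fun i => e (Pi.single i 1)) = 1 := by
  ext j l
  have h := congrFun (congrArg e (pi_eq_sum_univ' (e.symm (Pi.single j 1)))) l
  simp only [LinearEquiv.apply_symm_apply, map_sum, map_smul, Finset.sum_apply, Pi.smul_apply,
    smul_eq_mul] at h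
  rw [Matrix.mul_apply, Matrix.one_eq_pi_single, h]
  rfl

/-- Over an amenable algebra, a matrix with a left inverse has at least as many rows as columns. -/
theorem IsAmenableAlgebra.le_of_matrix_mul_eq_one {k A : Type*} [Field k] [Ring A] [Algebra k A]
    (hA : IsAmenableAlgebra k A) {m n : ℕ} {E : Matrix (Fin m) (Fin n) A}
    {F : Matrix (Fin n) (Fin m) A} (h : F * E = 1) : n ≤ m := by
  let r : Fin (m * n) → A := fun p => E (finProdFinEquiv.symm p).1 (finProdFinEquiv.symm p).2
  obtain ⟨V, hV, hfin, hlt⟩ := hA (m * n) r (1 / (m + 1)) (by positivity)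
  set W : Submodule k A := ⨆ i, V.map (LinearMap.mulLeft k (r i))
  have hmem (i : Fin m) (j : Fin n) (v : V) : E i j * v ∈ W := by
    refine Submodule.mem_iSup_of_mem (finProdFinEquiv (i, j)) ⟨v, v.2, ?_⟩
    simp only [r, Equiv.symm_apply_apply, LinearMap.mulLeft_apply]
  let f : (Fin n → V) →ₗ[k] (Fin m → W) := LinearMap.pi fun i =>
    ∑ j, (((LinearMap.mulLeft k (E i j)).comp V.subtype).codRestrict W (hmem i j)).comp
      (LinearMap.proj j)
  have hf (v : Fin n → V) : (fun i => (f v i : A)) = E.mulVec fun j => (v j : A) := by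
    ext i
    simp only [f, LinearMap.pi_apply, LinearMap.sum_apply, AddSubmonoidClass.coe_finsetSum]
    rfl
  have hinj : Function.Injective f := by
    intro v w hvw
    have h1 : (E.mulVec fun j => (v j : A)) = E.mulVec fun j => (w j : A) := by
      rw [← hf, ← hf, hvw]
    have h2 := congrArg F.mulVec h1
    simp only [Matrix.mulVec_mulVec, h, Matrix.one_mulVec] at h2
    exact funext fun j => Subtype.ext (congrFun h2 j)
  have hle := LinearMap.finrank_le_finrank_of_injective hinj
  simp only [Module.finrank_pi_fintype, Finset.sum_const, Finset.card_univ, Fintype.card_fin,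
    smul_eq_mul] at hle
  have hle' : (n * Module.finrank k V : ℝ) ≤ m * Module.finrank k W := by exact_mod_cast hle
  have hpos : (0 : ℝ) < Module.finrank k V := by
    have := Submodule.one_le_finrank_iff.mpr hV
    exact_mod_cast this
  have hm : (m : ℝ) * (1 + 1 / (m + 1)) < m + 1 := by
    field_simp
    nlinarith
  have hbound : (n : ℝ) * Module.finrank k V < (m + 1) * Module.finrank k V :=
    calc (n : ℝ) * Module.finrank k V ≤ m * Module.finrank k W := hle'
      _ ≤ m * ((1 + 1 / (m + 1)) * Module.finrank k V) := by gcongr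
      _ = m * (1 + 1 / (m + 1)) * Module.finrank k V := by ring
      _ < (m + 1) * Module.finrank k V := by gcongr
  have hnm : (n : ℝ) < m + 1 := lt_of_mul_lt_mul_right hbound hpos.le
  exact Nat.lt_succ_iff.mp (by exact_mod_cast hnm)

/-- An amenable algebra has the invariant basis number property: if the free left
`A`-modules `A^m` and `A^n` are isomorphic, then `m = n`. -/
theorem amenable_ibn (k A : Type*) [Field k] [Ring A] [Nontrivial A] [Algebra k A]
    (hA : IsAmenableAlgebra k A) (m n : ℕ)
    (e : (Fin m → A) ≃ₗ[A] (Fin n → A)) : m = n := by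
  exact le_antisymm (hA.le_of_matrix_mul_eq_one (toMatrix_symm_mul_toMatrix e.symm))
    (hA.le_of_matrix_mul_eq_one (toMatrix_symm_mul_toMatrix e))
end
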